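/- Let μ be the Haar measure on the additive group of ℚ_2 normalized so that ℤ_2 has measure 1. Then ∫_{E ∩ Y_{−1}} |1 − y|_2^{−1} |y|_2^{−1/2} · (1 − (1/3)|y|_2^{1/2} |1 − y|_2^{−1/2}) dμ(y) = 13/36. -/

import Mathlib

open MeasureTheory

/-- The unit part `u = y · 2^{-v₂(y)}` of a 2-adic number `y`. -/
noncomputable def unitPart (y : ℚ_[2]) : ℚ_[2] := y * (2 : ℚ_[2]) ^ (-y.valuation)

/-- `Y₋₁ = {y ∈ ℚ₂^× : v₂(y) even, u ≡ 5 (mod 8)}`. -/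
def YnegOne : Set ℚ_[2] := {y | y ≠ 0 ∧ Even y.valuation ∧ ‖unitPart y - 5‖ ≤ 8⁻¹}

/-- `E = {y ∈ ℚ₂, y ≠ 1 : v₂(1-y) even, v₂(1-y) ≤ 2}`. -/
def Eset : Set ℚ_[2] := {y | y ≠ 1 ∧ Even (1 - y).valuation ∧ (1 - y).valuation ≤ 2}

/-- The closed ball `4^k (5 + 8ℤ₂)`, the part of `Y₋₁` of valuation `2k`. -/
def shell (k : ℤ) : Set ℚ_[2] := Metric.closedBall (5 * 2 ^ (2 * k)) (2 ^ (-(2 * k) - 3))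

/-- The value of the integrand on `shell k`. -/
noncomputable def shellValue (k : ℤ) : ℝ :=
  if k = 0 then 4 / 3 else if 0 < k then 2 ^ k - 1 / 3 else 2 / 3 * 8 ^ k

lemma norm_two_zpow (n : ℤ) : ‖(2 : ℚ_[2]) ^ n‖ = 2 ^ (-n) := by
  exact_mod_cast Padic.norm_p_zpow (p := 2) n

lemma norm_five : ‖(5 : ℚ_[2])‖ = 1 := by
  have := (Padic.norm_natCast_eq_one_iff (p := 2) (n := 5)).2 (by norm_num)
  exact_mod_cast this

lemma ne_zero_of_norm_eq_two_zpow {x : ℚ_[2]} {n : ℤ} (h : ‖x‖ = 2 ^ (-n)) : x ≠ 0 := by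
  rw [← norm_ne_zero_iff, h]
  positivity

lemma valuation_eq_of_norm_eq {x : ℚ_[2]} {n : ℤ} (h : ‖x‖ = 2 ^ (-n)) : x.valuation = n := by
  have h1 := Padic.norm_eq_zpow_neg_valuation (ne_zero_of_norm_eq_two_zpow h)
  rw [h] at h1
  have := zpow_right_injective₀ (a := (2 : ℝ)) (by norm_num) (by norm_num) h1
  simp only [neg_inj] at this
  exact this.symm

lemma norm_of_mem_shell {k : ℤ} {y : ℚ_[2]} (hy : y ∈ shell k) : ‖y‖ = 2 ^ (-(2 * k)) := by
  rw [shell, mem_closedBall_iff_norm] at hy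
  have h5 : ‖(5 : ℚ_[2]) * 2 ^ (2 * k)‖ = 2 ^ (-(2 * k)) := by
    rw [norm_mul, norm_five, norm_two_zpow, one_mul]
  have hlt : ‖y - 5 * 2 ^ (2 * k)‖ < ‖(5 : ℚ_[2]) * 2 ^ (2 * k)‖ := by
    rw [h5]
    exact hy.trans_lt (zpow_lt_zpow_right₀ (by norm_num) (by lia))
  have := Padic.add_eq_max_of_ne hlt.ne
  rwa [sub_add_cancel, max_eq_right hlt.le, h5] at this

lemma norm_one_sub_of_mem_shell {k : ℤ} {y : ℚ_[2]} (hy : y ∈ shell k) :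
    ‖1 - y‖ = 2 ^ (-(if k = 0 then 2 else if 0 < k then 0 else 2 * k : ℤ)) := by
  have hn := norm_of_mem_shell hy
  split_ifs with h0 h1
  · subst h0
    rw [shell, mem_closedBall_iff_norm'] at hy
    norm_num at hy
    have h4 : ‖(-4 : ℚ_[2])‖ = 2 ^ (-2 : ℤ) := by
      rw [norm_neg, ← norm_two_zpow]
      norm_num
    have hlt : ‖5 - y‖ < ‖(-4 : ℚ_[2])‖ := by
      rw [h4]
      exact hy.trans_lt (by norm_num)
    have := Padic.add_eq_max_of_ne hlt.ne
    rw [max_eq_right hlt.le, h4] at this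
    rw [← this]
    congr 1
    ring
  · have hlt : ‖-y‖ < ‖(1 : ℚ_[2])‖ := by
      rw [norm_neg, hn, norm_one]
      exact zpow_lt_one_of_neg₀ (by norm_num) (by lia)
    have := Padic.add_eq_max_of_ne hlt.ne'
    rw [max_eq_left hlt.le, norm_one] at this
    rw [sub_eq_add_neg, this]
    norm_num
  · have hlt : ‖(1 : ℚ_[2])‖ < ‖-y‖ := by
      rw [norm_neg, hn, norm_one]
      exact one_lt_zpow₀ (by norm_num) (by lia)
    have := Padic.add_eq_max_of_ne hlt.ne
    rw [max_eq_right hlt.le, norm_neg, hn] at this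
    rw [sub_eq_add_neg, this]

lemma norm_unitPart_sub_five (y : ℚ_[2]) :
    ‖unitPart y - 5‖ = ‖y - 5 * 2 ^ y.valuation‖ * 2 ^ y.valuation := by
  have h : unitPart y - 5 = (y - 5 * 2 ^ y.valuation) * 2 ^ (-y.valuation) := by
    rw [unitPart, sub_mul, mul_assoc, ← zpow_add₀ (by norm_num)]
    simp
  rw [h, norm_mul, norm_two_zpow, neg_neg]

lemma norm_unitPart_sub_five_le_iff (y : ℚ_[2]) :
    ‖unitPart y - 5‖ ≤ 8⁻¹ ↔ ‖y - 5 * 2 ^ y.valuation‖ ≤ 2 ^ (-y.valuation - 3) := by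
  rw [norm_unitPart_sub_five, ← le_div_iff₀ (by positivity), zpow_sub₀ (by norm_num), zpow_neg]
  norm_num [div_eq_mul_inv, mul_comm]

lemma YnegOne_eq_iUnion_shell : YnegOne = ⋃ k, shell k := by
  ext y
  simp only [YnegOne, Set.mem_ofPred_eq, Set.mem_iUnion, norm_unitPart_sub_five_le_iff]
  constructor
  · rintro ⟨-, ⟨k, hk⟩, h⟩
    refine ⟨k, ?_⟩
    rwa [shell, mem_closedBall_iff_norm, two_mul, ← hk]
  · rintro ⟨k, hk⟩
    have hn := norm_of_mem_shell hk
    have hv := valuation_eq_of_norm_eq hn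
    refine ⟨ne_zero_of_norm_eq_two_zpow hn, hv ▸ even_two_mul k, ?_⟩
    rwa [hv, ← mem_closedBall_iff_norm]

lemma shell_subset_Eset (k : ℤ) : shell k ⊆ Eset := by
  intro y hy
  have hn := norm_one_sub_of_mem_shell hy
  refine ⟨fun h => ne_zero_of_norm_eq_two_zpow hn (by rw [h, sub_self]), ?_⟩
  rw [valuation_eq_of_norm_eq hn]
  split_ifs
  · exact ⟨even_two, le_rfl⟩
  · exact ⟨Even.zero, by norm_num⟩
  · exact ⟨even_two_mul k, by lia⟩

lemma Eset_inter_YnegOne : Eset ∩ YnegOne = ⋃ k, shell k := by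
  rw [YnegOne_eq_iUnion_shell]
  exact Set.inter_eq_right.2 (Set.iUnion_subset shell_subset_Eset)

lemma pairwise_disjoint_shell : Pairwise (Function.onFun Disjoint shell) := by
  intro j k hjk
  rw [Function.onFun, Set.disjoint_left]
  intro y hj hk
  have h1 := valuation_eq_of_norm_eq (norm_of_mem_shell hj)
  have h2 := valuation_eq_of_norm_eq (norm_of_mem_shell hk)
  lia

lemma two_zpow_two_mul_rpow_half (k : ℤ) : ((2 : ℝ) ^ (2 * k)) ^ (1 / 2 : ℝ) = 2 ^ k := by
  rw [← Real.sqrt_eq_rpow, mul_comm, zpow_mul]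
  exact_mod_cast Real.sqrt_sq (by positivity)

lemma two_zpow_two_mul_rpow_neg_half (k : ℤ) :
    ((2 : ℝ) ^ (2 * k)) ^ (-(1 / 2) : ℝ) = 2 ^ (-k) := by
  rw [Real.rpow_neg (by positivity), two_zpow_two_mul_rpow_half, zpow_neg]

lemma integrand_eq_shellValue {k : ℤ} {y : ℚ_[2]} (hy : y ∈ shell k) :
    ‖1 - y‖⁻¹ * ‖y‖ ^ (-(1/2) : ℝ) *
      (1 - (1/3) * ‖y‖ ^ ((1/2) : ℝ) * ‖1 - y‖ ^ (-(1/2) : ℝ)) = shellValue k := by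
  have h1 := two_zpow_two_mul_rpow_half (-k)
  have h2 := two_zpow_two_mul_rpow_neg_half (-k)
  rw [mul_neg] at h1 h2
  rw [norm_of_mem_shell hy, norm_one_sub_of_mem_shell hy, h1, h2, shellValue]
  split_ifs with h h'
  · subst h
    norm_num
  · simp only [neg_zero, zpow_zero, Real.one_rpow, neg_neg, zpow_neg]
    field
  · have h8 : (8 : ℝ) ^ k = 2 ^ k * 2 ^ k * 2 ^ k := by
      rw [← mul_zpow, ← mul_zpow]
      norm_num
    rw [h2, h8, neg_neg, ← zpow_neg, neg_neg, two_mul, zpow_add₀ (by norm_num), zpow_neg]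
    field

lemma closedBall_two_zpow_add_one (n : ℤ) :
    Metric.closedBall (0 : ℚ_[2]) (2 ^ (n + 1)) =
      Metric.closedBall 0 (2 ^ n) ∪ Metric.closedBall (2 ^ (-(n + 1))) (2 ^ n) := by
  have hc : ‖(2 : ℚ_[2]) ^ (-(n + 1))‖ = 2 ^ (n + 1) := by rw [norm_two_zpow, neg_neg]
  have hle : (2 : ℝ) ^ n ≤ 2 ^ (n + 1) := zpow_le_zpow_right₀ (by norm_num) (by lia)
  ext x
  simp only [Set.mem_union, mem_closedBall_iff_norm, sub_zero]
  constructor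
  · intro hx
    have hz : ‖x * 2 ^ (n + 1)‖ ≤ 1 := by
      rw [norm_mul, norm_two_zpow, zpow_neg]
      exact mul_inv_le_one_of_le₀ hx (by positivity)
    obtain ⟨z, hzx⟩ : ∃ z : ℤ_[2], (z : ℚ_[2]) = x * 2 ^ (n + 1) := ⟨⟨_, hz⟩, rfl⟩
    obtain ⟨m, hm, hxm⟩ := PadicInt.exists_mem_range z
    rw [IsLocalRing.mem_maximalIdeal, PadicInt.mem_nonunits] at hxm
    have hxm' : ‖x * 2 ^ (n + 1) - (m : ℚ_[2])‖ < 1 := by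
      rwa [PadicInt.norm_def, PadicInt.coe_sub, PadicInt.coe_natCast, hzx] at hxm
    have key : ‖x - m * 2 ^ (-(n + 1))‖ ≤ 2 ^ n := by
      have h := (Padic.norm_le_pow_iff_norm_lt_pow_add_one (p := 2)
        (x - m * 2 ^ (-(n + 1))) n).2
      refine h ?_
      have heq : x - m * 2 ^ (-(n + 1)) = (x * 2 ^ (n + 1) - m) * 2 ^ (-(n + 1)) := by
        rw [sub_mul, mul_assoc, ← zpow_add₀ (by norm_num), add_neg_cancel, zpow_zero, mul_one]
      rw [heq, norm_mul, hc]
      exact mul_lt_of_lt_one_left (by positivity) hxm'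
    interval_cases m
    · left; simpa using key
    · right; simpa using key
  · rintro (h | h)
    · exact h.trans hle
    · have := Padic.nonarchimedean (x - 2 ^ (-(n + 1))) (2 ^ (-(n + 1)))
      rw [sub_add_cancel, hc] at this
      exact this.trans (max_le (h.trans hle) le_rfl)

lemma disjoint_closedBall_two_zpow (n : ℤ) :
    Disjoint (Metric.closedBall (0 : ℚ_[2]) (2 ^ n))
      (Metric.closedBall (2 ^ (-(n + 1))) (2 ^ n)) := by
  rw [Set.disjoint_left]
  intro x h1 h2
  rw [mem_closedBall_iff_norm, sub_zero] at h1
  rw [mem_closedBall_iff_norm'] at h2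
  have := Padic.nonarchimedean (2 ^ (-(n + 1)) - x) x
  rw [sub_add_cancel, norm_two_zpow, neg_neg] at this
  have hlt : (2 : ℝ) ^ n < 2 ^ (n + 1) := zpow_lt_zpow_right₀ (by norm_num) (by lia)
  exact absurd (this.trans (max_le h2 h1)) hlt.not_ge

section Measure

variable [MeasurableSpace ℚ_[2]] [BorelSpace ℚ_[2]] (μ : Measure ℚ_[2]) [μ.IsAddHaarMeasure]

lemma measureReal_closedBall_center (c : ℚ_[2]) (r : ℝ) :
    μ.real (Metric.closedBall c r) = μ.real (Metric.closedBall 0 r) := by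
  rw [Measure.real, Measure.real, Measure.addHaar_closedBall_center]

lemma measureReal_closedBall_add_one (n : ℤ) :
    μ.real (Metric.closedBall (0 : ℚ_[2]) (2 ^ (n + 1))) =
      2 * μ.real (Metric.closedBall (0 : ℚ_[2]) (2 ^ n)) := by
  rw [closedBall_two_zpow_add_one, measureReal_union (disjoint_closedBall_two_zpow n)
    Metric.isClosed_closedBall.measurableSet measure_closedBall_lt_top.ne
    measure_closedBall_lt_top.ne, measureReal_closedBall_center μ (2 ^ (-(n + 1))), two_mul]

variable {μ}

lemma measureReal_closedBall_two_zpow (hvol : μ {x : ℚ_[2] | ‖x‖ ≤ 1} = 1) (c : ℚ_[2]) (n : ℤ) :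
    μ.real (Metric.closedBall c (2 ^ n)) = 2 ^ n := by
  rw [measureReal_closedBall_center]
  induction n with
  | zero =>
    have : Metric.closedBall (0 : ℚ_[2]) 1 = {x | ‖x‖ ≤ 1} := by ext; simp
    rw [zpow_zero, this, Measure.real, hvol, ENNReal.toReal_one]
  | succ n ih => rw [measureReal_closedBall_add_one, ih, zpow_add_one₀ (by norm_num), mul_comm]
  | pred n ih =>
    have h := measureReal_closedBall_add_one μ (-(n : ℤ) - 1)
    rw [sub_add_cancel, ih] at h
    rw [zpow_sub_one₀ (by norm_num) (-(n : ℤ))] at h ⊢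
    linarith

lemma measureReal_shell (hvol : μ {x : ℚ_[2] | ‖x‖ ≤ 1} = 1) (k : ℤ) :
    μ.real (shell k) = 4 ^ (-k) / 8 := by
  rw [shell, measureReal_closedBall_two_zpow hvol, zpow_sub₀ (by norm_num), ← mul_neg, zpow_mul]
  norm_num

end Measure

lemma shellValue_nonneg (k : ℤ) : 0 ≤ shellValue k := by
  rw [shellValue]
  split_ifs with h h'
  · norm_num
  · have : (1 : ℝ) ≤ 2 ^ k := one_le_zpow₀ (by norm_num) h'.le
    linarith
  · positivity

lemma hasSum_measure_mul_shellValue :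
    HasSum (fun k : ℤ => (4 : ℝ) ^ (-k) / 8 * shellValue k) (13 / 36) := by
  have g2 : HasSum (fun n : ℕ => (1 / 2 : ℝ) ^ n) 2 := hasSum_geometric_two
  have g4 : HasSum (fun n : ℕ => (1 / 4 : ℝ) ^ n) (4 / 3) := by
    convert hasSum_geometric_of_lt_one (r := (1 / 4 : ℝ)) (by norm_num) (by norm_num) using 1
    norm_num
  have hpos : HasSum (fun n : ℕ => (4 : ℝ) ^ (-((n : ℤ) + 1)) / 8 * shellValue (n + 1))
      (1 / 16 * 2 - 1 / 96 * (4 / 3)) := by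
    refine ((g2.mul_left (1 / 16)).sub (g4.mul_left (1 / 96))).congr_fun fun n => ?_
    have h4 : (4 : ℝ) ^ n = 2 ^ n * 2 ^ n := by rw [← mul_pow]; norm_num
    rw [shellValue, if_neg (by lia), if_pos (by lia), zpow_neg, zpow_add_one₀ (by norm_num),
      zpow_add_one₀ (by norm_num), zpow_natCast, zpow_natCast, one_div_pow, one_div_pow, h4]
    field
  have hneg : HasSum (fun n : ℕ => (4 : ℝ) ^ (-(-((n : ℤ) + 1))) / 8 * shellValue (-(n + 1)))
      (1 / 24 * 2) := by
    refine (g2.mul_left (1 / 24)).congr_fun fun n => ?_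
    have h4 : (4 : ℝ) ^ n = 2 ^ n * 2 ^ n := by rw [← mul_pow]; norm_num
    have h8 : (8 : ℝ) ^ n = 2 ^ n * 2 ^ n * 2 ^ n := by rw [← mul_pow, ← mul_pow]; norm_num
    rw [shellValue, if_neg (by lia), if_neg (by lia), neg_neg, zpow_neg, zpow_add_one₀ (by norm_num),
      zpow_add_one₀ (by norm_num), zpow_natCast, zpow_natCast, one_div_pow, h4, h8]
    field
  convert HasSum.of_add_one_of_neg_add_one
    (f := fun k : ℤ => (4 : ℝ) ^ (-k) / 8 * shellValue k) hpos hneg using 1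
  norm_num [shellValue]

/-- With `μ` the additive Haar measure on `ℚ₂` normalized so that `ℤ₂` has
measure 1,
`∫_{E ∩ Y₋₁} |1-y|₂⁻¹ |y|₂^{-1/2} (1 - (1/3)|y|₂^{1/2}|1-y|₂^{-1/2}) dμ(y) = 13/36`. -/
theorem stmt14 [MeasurableSpace ℚ_[2]] [BorelSpace ℚ_[2]]
    (μ : Measure ℚ_[2]) [μ.IsAddHaarMeasure]
    (hvol : μ {x : ℚ_[2] | ‖x‖ ≤ 1} = 1) :
    ∫ y in Eset ∩ YnegOne,
        ‖1 - y‖⁻¹ * ‖y‖ ^ (-(1/2) : ℝ) *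
          (1 - (1/3) * ‖y‖ ^ ((1/2) : ℝ) * ‖1 - y‖ ^ (-(1/2) : ℝ)) ∂μ = 13/36 := by
  have hm (k : ℤ) : MeasurableSet (shell k) := Metric.isClosed_closedBall.measurableSet
  have hfin (k : ℤ) : μ (shell k) ≠ ⊤ := measure_closedBall_lt_top.ne
  set f : ℚ_[2] → ℝ := fun y => ‖1 - y‖⁻¹ * ‖y‖ ^ (-(1/2) : ℝ) *
    (1 - (1/3) * ‖y‖ ^ ((1/2) : ℝ) * ‖1 - y‖ ^ (-(1/2) : ℝ))
  have hfk (k : ℤ) : Set.EqOn f (fun _ => shellValue k) (shell k) :=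
    fun y hy => integrand_eq_shellValue hy
  have hint (k : ℤ) : ∫ y in shell k, f y ∂μ = 4 ^ (-k) / 8 * shellValue k := by
    rw [setIntegral_congr_fun (hm k) (hfk k), setIntegral_const, measureReal_shell hvol,
      smul_eq_mul]
  have hnorm (k : ℤ) : ∫ y in shell k, ‖f y‖ ∂μ = 4 ^ (-k) / 8 * shellValue k := by
    rw [← hint]
    refine setIntegral_congr_fun (hm k) fun y hy => ?_
    simp only [hfk k hy, Real.norm_of_nonneg (shellValue_nonneg k)]
  have hon : IntegrableOn f (⋃ k, shell k) μ := by
    refine integrableOn_iUnion_of_summable_integral_norm (fun k => ?_) ?_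
    · exact (integrableOn_const (hfin k)).congr_fun (hfk k).symm (hm k)
    · simp only [hnorm]
      exact hasSum_measure_mul_shellValue.summable
  have hsum := hasSum_integral_iUnion hm pairwise_disjoint_shell hon
  simp only [hint] at hsum
  rw [Eset_inter_YnegOne]
  exact hsum.unique hasSum_measure_mul_shellValue
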